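/- arXiv:1711.02533 — 8 statements merged into one kernel-verified Lean document; each statement's English description precedes it below -/
import Mathlib

section
/- Let a > d > 0, b = √(a² − d²), k > 0 and ȧ ∈ ℝ, and define p(x,y) = (ȧ/(2k·a·(a² − d²)))·(d²x² − a²(x² + y²) + a²(a² − d²)). Then: (i) the Laplacian of p is identically −ȧ·(2a² − d²)/(k·a·(a² − d²)); (ii) p(x,y) = 0 for every (x,y) on the ellipse x²/a² + y²/b² = 1; (iii) with ḃ = a·ȧ/b (the rate forced by keeping a² − b² = d² constant), one has −ȧ·(2a² − d²)/(a·(a² − d²)) = −(ȧ·b + a·ḃ)/(a·b), i.e. Δp = (1/k)·(ḣ/h) where ḣ/h = −∂ₜ(ab)/(ab) is the logarithmic gap rate dictated by volume conservation h·a·b = const. -/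
theorem deriv_deriv_mul_sq_add (α β t : ℝ) :
    deriv (fun s => deriv (fun r : ℝ => α * r ^ 2 + β) s) t = 2 * α := by
  have h : (fun s => deriv (fun r : ℝ => α * r ^ 2 + β) s) = fun s => 2 * α * s := by
    funext s
    have := (((hasDerivAt_id s).pow 2).const_mul α).add_const β
    refine HasDerivAt.deriv (this.congr_deriv ?_)
    simp
    ring
  rw [h]
  simp

/-- Confocal-ellipse (source-free) exact pressure for the squeeze-driven Muskat problem:
`p(x,y) = (ȧ/(2k a(a² − d²)))·(d²x² − a²(x² + y²) + a²(a² − d²))` has constant Laplacian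
`−ȧ(2a² − d²)/(k a(a² − d²))`, vanishes on the ellipse `x²/a² + y²/b² = 1` with
`b = √(a² − d²)`, and with `ḃ = aȧ/b` the Laplacian equals `(1/k)·(ḣ/h)` where
`ḣ/h = −∂ₜ(ab)/(ab)`. -/
theorem stmt_2 (a d k adot : ℝ) (hd : 0 < d) (had : d < a) (hk : 0 < k) :
    let b : ℝ := Real.sqrt (a ^ 2 - d ^ 2)
    let p : ℝ → ℝ → ℝ := fun x y =>
      (adot / (2 * k * a * (a ^ 2 - d ^ 2))) *
        (d ^ 2 * x ^ 2 - a ^ 2 * (x ^ 2 + y ^ 2) + a ^ 2 * (a ^ 2 - d ^ 2))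
    (∀ x y : ℝ,
      deriv (fun x' => deriv (fun x'' => p x'' y) x') x
        + deriv (fun y' => deriv (fun y'' => p x y'') y') y
        = -(adot * (2 * a ^ 2 - d ^ 2)) / (k * a * (a ^ 2 - d ^ 2))) ∧
    (∀ x y : ℝ, x ^ 2 / a ^ 2 + y ^ 2 / b ^ 2 = 1 → p x y = 0) ∧
    (let bdot : ℝ := a * adot / b;
     -(adot * (2 * a ^ 2 - d ^ 2)) / (a * (a ^ 2 - d ^ 2))
       = -((adot * b + a * bdot) / (a * b))) := by
  intro b p
  have ha : 0 < a := hd.trans had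
  have hD : 0 < a ^ 2 - d ^ 2 := by nlinarith
  have hb : 0 < b := Real.sqrt_pos.mpr hD
  have hb2 : b ^ 2 = a ^ 2 - d ^ 2 := Real.sq_sqrt hD.le
  have ha0 := ha.ne'
  have hk0 := hk.ne'
  have hb0 := hb.ne'
  have hD0 := hD.ne'
  refine ⟨fun x y => ?_, fun x y hxy => ?_, ?_⟩
  · set C := adot / (2 * k * a * (a ^ 2 - d ^ 2)) with hC
    have hx : (fun x'' => p x'' y) = fun r =>
        C * (d ^ 2 - a ^ 2) * r ^ 2 + C * (a ^ 2 * (a ^ 2 - d ^ 2) - a ^ 2 * y ^ 2) := by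
      funext r
      simp only [p]
      ring
    have hy : (fun y'' => p x y'') = fun r =>
        C * (-a ^ 2) * r ^ 2 +
          C * (d ^ 2 * x ^ 2 - a ^ 2 * x ^ 2 + a ^ 2 * (a ^ 2 - d ^ 2)) := by
      funext r
      simp only [p]
      ring
    rw [hx, hy, deriv_deriv_mul_sq_add, deriv_deriv_mul_sq_add, hC]
    field_simp
    ring
  · have h : x ^ 2 * b ^ 2 + y ^ 2 * a ^ 2 = a ^ 2 * b ^ 2 := by
      field_simp at hxy
      linarith
    rw [hb2] at h
    exact mul_eq_zero_of_right _ (by linarith)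
  · intro bdot
    have h : (adot * b + a * bdot) / (a * b) = adot * (b ^ 2 + a ^ 2) / (a * b ^ 2) := by
      simp only [bdot]
      field_simp
    rw [h, hb2, neg_div]
    ring
end

section
/- Let a > d > 0, b = √(a² − d²), k > 0, ȧ ∈ ℝ and ḃ = a·ȧ/b, and let p(x,y) = (ȧ/(2k·a·(a² − d²)))·(d²x² − a²(x² + y²) + a²(a² − d²)). Parametrize the ellipse by γ(θ) = (a·cos θ, b·sin θ) with (unnormalized) outward normal N(θ) = (b·cos θ, a·sin θ). Then for every θ ∈ ℝ, the boundary velocity (ȧ·cos θ, ḃ·sin θ) satisfies ⟨(ȧ·cos θ, ḃ·sin θ), N(θ)⟩ = −k·⟨∇p(γ(θ)), N(θ)⟩. That is, the kinematic free-boundary condition v_n = −k·∂p/∂n holds on the ellipse for the confocal evolution. -/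
/-- Derivative of a scaled quadratic polynomial without linear term. -/
lemma deriv_const_mul_quadratic (C α β x : ℝ) (f : ℝ → ℝ)
    (hf : ∀ t, f t = C * (α * t ^ 2 + β)) : deriv f x = C * (2 * α * x) := by
  have h : HasDerivAt (fun t : ℝ => C * (α * t ^ 2 + β)) (C * (α * (2 * x))) x := by
    simpa using (((hasDerivAt_pow 2 x).const_mul α).add_const β).const_mul C
  rw [funext hf, h.deriv]
  ring

/-- Kinematic free-boundary condition `v_n = −k ∂p/∂n` on the confocal ellipse family:
with `b = √(a² − d²)`, `ḃ = aȧ/b`, boundary point `γ(θ) = (a cos θ, b sin θ)`,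
unnormalized outward normal `N(θ) = (b cos θ, a sin θ)`, and pressure
`p(x,y) = (ȧ/(2k a(a² − d²)))·(d²x² − a²(x² + y²) + a²(a² − d²))`, the boundary velocity
`(ȧ cos θ, ḃ sin θ)` satisfies `⟨v, N⟩ = −k⟨∇p(γ(θ)), N⟩` for all `θ`. -/
theorem stmt_3 (a d k adot : ℝ) (hd : 0 < d) (had : d < a) (hk : 0 < k) :
    let b : ℝ := Real.sqrt (a ^ 2 - d ^ 2)
    let bdot : ℝ := a * adot / b
    let p : ℝ → ℝ → ℝ := fun x y =>
      (adot / (2 * k * a * (a ^ 2 - d ^ 2))) *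
        (d ^ 2 * x ^ 2 - a ^ 2 * (x ^ 2 + y ^ 2) + a ^ 2 * (a ^ 2 - d ^ 2))
    ∀ θ : ℝ,
      (adot * Real.cos θ) * (b * Real.cos θ) + (bdot * Real.sin θ) * (a * Real.sin θ)
        = -k * ((deriv (fun x => p x (b * Real.sin θ)) (a * Real.cos θ)) * (b * Real.cos θ)
              + (deriv (fun y => p (a * Real.cos θ) y) (b * Real.sin θ)) * (a * Real.sin θ)) := by
  intro b bdot p θ
  have ha : 0 < a := hd.trans had
  have hpos : 0 < a ^ 2 - d ^ 2 := by nlinarith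
  have hb : 0 < b := Real.sqrt_pos.mpr hpos
  have hb2 : a ^ 2 - d ^ 2 = b ^ 2 := (Real.sq_sqrt hpos.le).symm
  rw [deriv_const_mul_quadratic (adot / (2 * k * a * b ^ 2)) (-b ^ 2)
      (-a ^ 2 * (b * Real.sin θ) ^ 2 + a ^ 2 * b ^ 2) (a * Real.cos θ) _
      (fun t => by simp only [p, ← hb2]; ring),
    deriv_const_mul_quadratic (adot / (2 * k * a * b ^ 2)) (-a ^ 2)
      (-b ^ 2 * (a * Real.cos θ) ^ 2 + a ^ 2 * b ^ 2) (b * Real.sin θ) _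
      (fun t => by simp only [p, ← hb2]; ring)]
  simp only [bdot]
  field_simp
  ring
end

section
/- Let u : ℝ² → ℝ be harmonic (C² with ∂²u/∂x² + ∂²u/∂y² = 0 everywhere). Let a₁ > b₁ > 0 and a₂ > b₂ > 0 satisfy a₁² − b₁² = a₂² − b₂². Then (1/(a₁·b₁))·∫_{x²/a₁² + y²/b₁² ≤ 1} u(x,y) dxdy = (1/(a₂·b₂))·∫_{x²/a₂² + y²/b₂² ≤ 1} u(x,y) dxdy. Equivalently, along any confocal ellipse evolution with gap width h(t) satisfying h(t)·a(t)·b(t) = const, the quantity h(t)·∫_{Ω₂(t)} u dxdy is conserved, where Ω₂(t) is the region enclosed by the ellipse with semi-axes a(t), b(t). -/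
open MeasureTheory

open Real in
theorem circleAverage_eq_of_differentiableOn_compl_center {c : ℂ} {f : ℂ → ℂ}
    (hf : DifferentiableOn ℂ f {c}ᶜ) {r R : ℝ} (hr : 0 < r) (hR : 0 < R) :
    circleAverage f c r = circleAverage f c R := by
  wlog hle : r ≤ R generalizing r R
  · exact (this hR hr (le_of_not_ge hle)).symm
  have hd : ∀ z, z ≠ c → DifferentiableAt ℂ f z := fun z hz =>
    hf.differentiableAt (isOpen_compl_singleton.mem_nhds hz)
  rw [circleAverage_eq_circleIntegral hr.ne', circleAverage_eq_circleIntegral hR.ne',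
    Complex.circleIntegral_sub_center_inv_smul_eq_of_differentiable_on_annulus_off_countable
      hr hle (s := ∅) Set.countable_empty]
  · rintro z ⟨-, hz⟩
    refine (hd z ?_).continuousAt.continuousWithinAt
    rintro rfl
    exact hz (Metric.mem_ball_self hr)
  · rintro z ⟨⟨-, hz⟩, -⟩
    refine hd z ?_
    rintro rfl
    exact hz (Metric.mem_closedBall_self hr.le)

/-- The mean of an entire function over an ellipse, with respect to the eccentric angle, is the mean
of its composition with the Joukowsky map over a circle. -/
theorem integral_ellipse_eq_circleAverage (F : ℂ → ℂ) {a b : ℝ} (hab : 0 < a + b) (r : ℝ) :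
    ∫ θ in (-Real.pi)..Real.pi, F ⟨a * (r * Real.cos θ), b * (r * Real.sin θ)⟩
      = (2 * Real.pi : ℝ) • Real.circleAverage
          (fun w => F (r * (w + ((a ^ 2 - b ^ 2) / 4 : ℝ) / w))) 0 ((a + b) / 2) := by
  rw [Real.circleAverage_eq_integral_add (-Real.pi), smul_inv_smul₀ (by positivity),
    intervalIntegral.integral_comp_add_right
      (fun θ => F (r * (circleMap 0 ((a + b) / 2) θ
        + ((a ^ 2 - b ^ 2) / 4 : ℝ) / circleMap 0 ((a + b) / 2) θ)))]
  have h2 : 2 * Real.pi + -Real.pi = Real.pi := by ring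
  rw [zero_add, h2]
  refine intervalIntegral.integral_congr fun θ _ => ?_
  have hne : ((a : ℂ) + b) ≠ 0 := by exact_mod_cast hab.ne'
  have key : ((a ^ 2 - b ^ 2) / 4 : ℝ) / circleMap 0 ((a + b) / 2) θ
      = (((a - b) / 2 : ℝ) : ℂ) * Complex.exp (-(θ * Complex.I)) := by
    simp only [circleMap, zero_add, Complex.exp_neg]
    have := Complex.exp_ne_zero (θ * Complex.I)
    push_cast
    field_simp
    ring
  simp only [key]
  congr 1
  rw [circleMap, zero_add, ← neg_mul, Complex.exp_mul_I, Complex.exp_mul_I, Complex.cos_neg,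
    Complex.sin_neg, ← Complex.ofReal_cos, ← Complex.ofReal_sin]
  apply Complex.ext
  · simp [-Complex.ofReal_cos, -Complex.ofReal_sin]
    ring
  · simp [-Complex.ofReal_cos, -Complex.ofReal_sin]
    ring

theorem integral_confocal_ellipse_eq {F : ℂ → ℂ} (hF : Differentiable ℂ F) {a₁ b₁ a₂ b₂ : ℝ}
    (h₁ : 0 < a₁ + b₁) (h₂ : 0 < a₂ + b₂) (hconf : a₁ ^ 2 - b₁ ^ 2 = a₂ ^ 2 - b₂ ^ 2) (r : ℝ) :
    ∫ θ in (-Real.pi)..Real.pi, F ⟨a₁ * (r * Real.cos θ), b₁ * (r * Real.sin θ)⟩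
      = ∫ θ in (-Real.pi)..Real.pi, F ⟨a₂ * (r * Real.cos θ), b₂ * (r * Real.sin θ)⟩ := by
  rw [integral_ellipse_eq_circleAverage F h₁, integral_ellipse_eq_circleAverage F h₂, hconf]
  congr 1
  refine circleAverage_eq_of_differentiableOn_compl_center ?_ (by positivity) (by positivity)
  intro w hw
  have hw : w ≠ 0 := hw
  refine DifferentiableAt.differentiableWithinAt ?_
  fun_prop (disch := assumption)

theorem deriv_deriv_comp_eq_fderiv_fderiv {E : Type*} [NormedAddCommGroup E] [NormedSpace ℝ E]
    {v : E → ℝ} (hv : ContDiff ℝ 2 v) {γ : ℝ → E} {e : E} (hγ : ∀ t, HasDerivAt γ e t) (t : ℝ) :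
    deriv (fun t' => deriv (fun s => v (γ s)) t') t = fderiv ℝ (fderiv ℝ v) (γ t) e e := by
  have h1 : (fun t' => deriv (fun s => v (γ s)) t') = fun t' => fderiv ℝ v (γ t') e := by
    funext t'
    exact ((hv.differentiable (by norm_num) (γ t')).hasFDerivAt.comp_hasDerivAt t' (hγ t')).deriv
  have h2 : Differentiable ℝ (fderiv ℝ v) :=
    (hv.fderiv_right (m := 1) (by norm_num)).differentiable (by norm_num)
  rw [h1]
  exact (((h2 (γ t)).hasFDerivAt.comp_hasDerivAt t (hγ t)).clm_apply
    (hasDerivAt_const t e)).deriv.trans (by simp)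

theorem exists_differentiable_re_eq_of_harmonic {u : ℝ × ℝ → ℝ} (hu : ContDiff ℝ 2 u)
    (hharm : ∀ x y : ℝ,
      deriv (fun x' => deriv (fun x'' => u (x'', y)) x') x
        + deriv (fun y' => deriv (fun y'' => u (x, y'')) y') y = 0) :
    ∃ F : ℂ → ℂ, Differentiable ℂ F ∧ ∀ x y : ℝ, u (x, y) = (F ⟨x, y⟩).re := by
  set v : ℂ → ℝ := fun z => u (Complex.equivRealProdCLM z) with hv_def
  have hv : ContDiff ℝ 2 v := hu.comp Complex.equivRealProdCLM.contDiff
  have hx (y t : ℝ) : HasDerivAt (fun s : ℝ => (⟨s, y⟩ : ℂ)) 1 t := by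
    have := (Complex.ofRealCLM.hasDerivAt (x := t)).add_const (y * Complex.I)
    simpa [Complex.mk_eq_add_mul_I] using this
  have hy (x t : ℝ) : HasDerivAt (fun s : ℝ => (⟨x, s⟩ : ℂ)) Complex.I t := by
    have := ((Complex.ofRealCLM.hasDerivAt (x := t)).mul_const Complex.I).const_add (x : ℂ)
    simpa [Complex.mk_eq_add_mul_I] using this
  have hΔ : Laplacian.laplacian v = 0 := by
    funext z
    rw [InnerProductSpace.laplacian_eq_iteratedFDeriv_complexPlane]
    simp only [iteratedFDeriv_two_apply, Pi.zero_apply]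
    have := hharm z.re z.im
    rw [← this]
    congr 1
    · exact (deriv_deriv_comp_eq_fderiv_fderiv hv (hx z.im) z.re).symm
    · exact (deriv_deriv_comp_eq_fderiv_fderiv hv (hy z.re) z.im).symm
  have hharmonic : InnerProductSpace.HarmonicOnNhd v Set.univ := fun z _ =>
    ⟨hv.contDiffAt, by rw [hΔ]⟩
  obtain ⟨F, hF, hre⟩ := hharmonic.exists_analyticOnNhd_univ_re_eq
  exact ⟨F, fun z => (hF z trivial).differentiableAt, fun x y => (congrFun hre ⟨x, y⟩).symm⟩

theorem setIntegral_unitDisk_eq_polar {f : ℝ × ℝ → ℝ} (hf : Continuous f) :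
    ∫ p in {p : ℝ × ℝ | p.1 ^ 2 + p.2 ^ 2 ≤ 1}, f p
      = ∫ r in Set.Ioc (0 : ℝ) 1,
          r * ∫ θ in (-Real.pi)..Real.pi, f (r * Real.cos θ, r * Real.sin θ) := by
  have hD : MeasurableSet {p : ℝ × ℝ | p.1 ^ 2 + p.2 ^ 2 ≤ 1} :=
    measurableSet_le (by fun_prop) (by fun_prop)
  have hcont : Continuous fun q : ℝ × ℝ => q.1 * f (q.1 * Real.cos q.2, q.1 * Real.sin q.2) := by
    fun_prop
  have hS : MeasurableSet (Set.Iic (1 : ℝ) ×ˢ (Set.univ : Set ℝ)) :=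
    measurableSet_Iic.prod MeasurableSet.univ
  have hset : polarCoord.target ∩ (Set.Iic (1 : ℝ) ×ˢ (Set.univ : Set ℝ))
      = Set.Ioc (0 : ℝ) 1 ×ˢ Set.Ioo (-Real.pi) Real.pi := by
    ext ⟨r, θ⟩
    simp [polarCoord]
    tauto
  rw [← integral_indicator hD, ← integral_comp_polarCoord_symm]
  have hcongr : ∫ q in polarCoord.target,
        q.1 • Set.indicator {p : ℝ × ℝ | p.1 ^ 2 + p.2 ^ 2 ≤ 1} f (polarCoord.symm q)
      = ∫ q in polarCoord.target, Set.indicator (Set.Iic (1 : ℝ) ×ˢ (Set.univ : Set ℝ))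
          (fun q : ℝ × ℝ => q.1 * f (q.1 * Real.cos q.2, q.1 * Real.sin q.2)) q := by
    refine setIntegral_congr_fun polarCoord.open_target.measurableSet ?_
    rintro ⟨r, θ⟩ ⟨hr, -⟩
    have hr : 0 < r := hr
    have hiff : (r * Real.cos θ) ^ 2 + (r * Real.sin θ) ^ 2 ≤ 1 ↔ r ≤ 1 := by
      have : (r * Real.cos θ) ^ 2 + (r * Real.sin θ) ^ 2 = r ^ 2 := by
        linear_combination r ^ 2 * Real.sin_sq_add_cos_sq θ
      rw [this, sq_le_one_iff₀ hr.le]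
    simp [Set.indicator_apply, hiff]
  rw [hcongr, setIntegral_indicator hS, hset, Measure.volume_eq_prod, setIntegral_prod]
  · refine setIntegral_congr_fun measurableSet_Ioc fun r _ => ?_
    simp only
    rw [integral_const_mul, intervalIntegral.integral_of_le (by linarith [Real.pi_pos]),
      integral_Ioc_eq_integral_Ioo]
  · exact (hcont.continuousOn.integrableOn_compact (isCompact_Icc.prod isCompact_Icc)).mono_set
      (Set.prod_mono Set.Ioc_subset_Icc_self Set.Ioo_subset_Icc_self)

theorem setIntegral_ellipse_eq_unitDisk (f : ℝ × ℝ → ℝ) {a b : ℝ} (ha : 0 < a) (hb : 0 < b) :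
    ∫ p in {p : ℝ × ℝ | p.1 ^ 2 / a ^ 2 + p.2 ^ 2 / b ^ 2 ≤ 1}, f p
      = a * b * ∫ p in {p : ℝ × ℝ | p.1 ^ 2 + p.2 ^ 2 ≤ 1}, f (a * p.1, b * p.2) := by
  have hD : MeasurableSet {p : ℝ × ℝ | p.1 ^ 2 + p.2 ^ 2 ≤ 1} :=
    measurableSet_le (by fun_prop) (by fun_prop)
  let L : ℝ × ℝ →L[ℝ] ℝ × ℝ :=
    (a • ContinuousLinearMap.id ℝ ℝ).prodMap (b • ContinuousLinearMap.id ℝ ℝ)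
  have hdet : L.det = a * b := by
    have : (L : ℝ × ℝ →ₗ[ℝ] ℝ × ℝ)
        = (a • LinearMap.id (R := ℝ) (M := ℝ)).prodMap (b • LinearMap.id (R := ℝ) (M := ℝ)) := rfl
    rw [ContinuousLinearMap.det, this, LinearMap.det_prodMap]
    simp
  have himage : L '' {p : ℝ × ℝ | p.1 ^ 2 + p.2 ^ 2 ≤ 1}
      = {p : ℝ × ℝ | p.1 ^ 2 / a ^ 2 + p.2 ^ 2 / b ^ 2 ≤ 1} := by
    ext ⟨x, y⟩
    constructor
    · rintro ⟨⟨s, t⟩, hst, h⟩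
      obtain ⟨rfl, rfl⟩ := Prod.mk.inj h
      simpa [mul_pow, ha.ne', hb.ne'] using hst
    · intro h
      refine ⟨(x / a, y / b), by simpa [div_pow] using h, ?_⟩
      simp [L, mul_div_cancel₀, ha.ne', hb.ne']
  have hinj : Function.Injective L := by
    rintro ⟨s, t⟩ ⟨s', t'⟩ h
    simpa [L, ha.ne', hb.ne'] using h
  rw [← himage, integral_image_eq_integral_abs_det_fderiv_smul volume hD
    (fun p _ => L.hasFDerivAt.hasFDerivWithinAt) hinj.injOn, hdet, abs_of_pos (mul_pos ha hb),
    ← integral_const_mul]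
  rfl

/-- Conservation of scaled harmonic moments for the confocal-ellipse Hele-Shaw evolution:
if `u` is harmonic on `ℝ²` and two ellipses are confocal (`a₁² − b₁² = a₂² − b₂²`), then
`(1/(a₁b₁)) ∫_{E₁} u = (1/(a₂b₂)) ∫_{E₂} u`; i.e. `h(t) ∫_{Ω₂(t)} u` is conserved along
an evolution with `h a b = const`. -/
theorem stmt_5 (u : ℝ × ℝ → ℝ) (hu : ContDiff ℝ 2 u)
    (hharm : ∀ x y : ℝ,
      deriv (fun x' => deriv (fun x'' => u (x'', y)) x') x
        + deriv (fun y' => deriv (fun y'' => u (x, y'')) y') y = 0)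
    (a₁ b₁ a₂ b₂ : ℝ) (hb₁ : 0 < b₁) (hba₁ : b₁ < a₁) (hb₂ : 0 < b₂) (hba₂ : b₂ < a₂)
    (hconf : a₁ ^ 2 - b₁ ^ 2 = a₂ ^ 2 - b₂ ^ 2) :
    (1 / (a₁ * b₁)) * (∫ p in {p : ℝ × ℝ | p.1 ^ 2 / a₁ ^ 2 + p.2 ^ 2 / b₁ ^ 2 ≤ 1}, u p)
      = (1 / (a₂ * b₂)) * (∫ p in {p : ℝ × ℝ | p.1 ^ 2 / a₂ ^ 2 + p.2 ^ 2 / b₂ ^ 2 ≤ 1}, u p) := by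
  obtain ⟨F, hF, hre⟩ := exists_differentiable_re_eq_of_harmonic hu hharm
  have ha₁ := hb₁.trans hba₁
  have ha₂ := hb₂.trans hba₂
  have hu := hu.continuous
  rw [setIntegral_ellipse_eq_unitDisk u ha₁ hb₁, setIntegral_ellipse_eq_unitDisk u ha₂ hb₂,
    ← mul_assoc _ (a₁ * b₁), ← mul_assoc _ (a₂ * b₂), one_div_mul_cancel (by positivity),
    one_div_mul_cancel (by positivity),
    setIntegral_unitDisk_eq_polar (by fun_prop), setIntegral_unitDisk_eq_polar (by fun_prop)]
  have hre_integral (a b r : ℝ) :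
      ∫ θ in (-Real.pi)..Real.pi, u (a * (r * Real.cos θ), b * (r * Real.sin θ))
        = (∫ θ in (-Real.pi)..Real.pi, F ⟨a * (r * Real.cos θ), b * (r * Real.sin θ)⟩).re := by
    have hcont : Continuous fun θ : ℝ => F ⟨a * (r * Real.cos θ), b * (r * Real.sin θ)⟩ := by
      refine hF.continuous.comp ?_
      simp only [Complex.mk_eq_add_mul_I]
      fun_prop
    simp only [hre]
    exact Complex.reCLM.intervalIntegral_comp_comm (hcont.intervalIntegrable _ _)
  simp only [hre_integral, integral_confocal_ellipse_eq hF (add_pos ha₁ hb₁) (add_pos ha₂ hb₂) hconf]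
end

section
/- Let 0 < b < a. The area (two-dimensional Lebesgue measure) of the region {(x,y) ∈ ℝ² : (x² + y²)² − 2b²(x² − y²) ≤ a⁴ − b⁴} enclosed by the Cassini oval equals 2a²·E(b²/a²), where E(k) = ∫₀^{π/2} √(1 − k²·sin²t) dt is the complete elliptic integral of the second kind. -/
open MeasureTheory Real

/-- A point at polar coordinates `(r, θ)` lies in the Cassini region iff
`r² ≤ b² cos 2θ + √(a⁴ - b⁴ sin² 2θ)`. -/
lemma cassini_polar_iff {a b : ℝ} (hb : 0 < b) (hba : b < a) (r θ : ℝ) :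
    ((r * cos θ) ^ 2 + (r * sin θ) ^ 2) ^ 2 - 2 * b ^ 2 * ((r * cos θ) ^ 2 - (r * sin θ) ^ 2)
      ≤ a ^ 4 - b ^ 4 ↔
    r ^ 2 ≤ b ^ 2 * cos (2 * θ) + √(a ^ 4 - b ^ 4 * sin (2 * θ) ^ 2) := by
  have hab : b ^ 4 < a ^ 4 := pow_lt_pow_left₀ hba hb.le (by norm_num)
  have hb4 : 0 < b ^ 4 := by positivity
  have h1 := sin_sq_add_cos_sq (2 * θ)
  have hrew : ((r * cos θ) ^ 2 + (r * sin θ) ^ 2) ^ 2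
      - 2 * b ^ 2 * ((r * cos θ) ^ 2 - (r * sin θ) ^ 2) =
      (r ^ 2 - b ^ 2 * cos (2 * θ)) ^ 2 - b ^ 4 * cos (2 * θ) ^ 2 := by
    have h2 := cos_two_mul' θ
    have h3 := sin_sq_add_cos_sq θ
    rw [h2]
    linear_combination (r ^ 4 * (cos θ ^ 2 + sin θ ^ 2 + 1)) * h3
  have hlt : b ^ 4 * cos (2 * θ) ^ 2 < a ^ 4 - b ^ 4 * sin (2 * θ) ^ 2 := by nlinarith
  rw [hrew, ← sub_le_iff_le_add']
  constructor
  · intro h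
    exact le_sqrt_of_sq_le (by nlinarith)
  · intro h
    have hs := sq_sqrt (show 0 ≤ a ^ 4 - b ^ 4 * sin (2 * θ) ^ 2 by
      nlinarith [sq_nonneg (b ^ 2 * cos (2 * θ))])
    have hle : -√(a ^ 4 - b ^ 4 * sin (2 * θ) ^ 2) ≤ r ^ 2 - b ^ 2 * cos (2 * θ) := by
      have : b ^ 2 * cos (2 * θ) ≤ √(a ^ 4 - b ^ 4 * sin (2 * θ) ^ 2) :=
        le_sqrt_of_sq_le (by nlinarith)
      nlinarith [sq_nonneg r]
    nlinarith [sq_le_sq' hle h]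

lemma cassini_radius_sq_nonneg {a b : ℝ} (hb : 0 < b) (hba : b < a) (θ : ℝ) :
    0 ≤ b ^ 2 * cos (2 * θ) + √(a ^ 4 - b ^ 4 * sin (2 * θ) ^ 2) := by
  have := (cassini_polar_iff hb hba 0 θ).1 (by
    have : b ^ 4 < a ^ 4 := pow_lt_pow_left₀ hba hb.le (by norm_num)
    simpa using this.le)
  simpa using this

lemma lintegral_Ioi_indicator_sq_le {c : ℝ} (hc : 0 ≤ c) :
    ∫⁻ r in Set.Ioi (0 : ℝ), ENNReal.ofReal r * {r : ℝ | r ^ 2 ≤ c}.indicator 1 r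
      = ENNReal.ofReal (c / 2) := by
  have hset : Set.Ioi (0 : ℝ) ∩ {r : ℝ | r ^ 2 ≤ c} = Set.Ioc 0 √c := by
    ext r
    simp only [Set.mem_inter_iff, Set.mem_Ioi, Set.mem_ofPred_eq, Set.mem_Ioc]
    exact and_congr_right fun hr => (le_sqrt hr.le hc).symm
  have hm : MeasurableSet {r : ℝ | r ^ 2 ≤ c} := measurableSet_le (by fun_prop) (by fun_prop)
  have hfun : (fun r : ℝ => ENNReal.ofReal r * {r : ℝ | r ^ 2 ≤ c}.indicator 1 r)
      = {r : ℝ | r ^ 2 ≤ c}.indicator ENNReal.ofReal := by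
    ext r
    by_cases h : r ∈ {r : ℝ | r ^ 2 ≤ c} <;> simp [h]
  rw [hfun, lintegral_indicator hm, Measure.restrict_restrict hm, Set.inter_comm, hset,
    ← ofReal_integral_eq_lintegral_ofReal, ← intervalIntegral.integral_of_le (sqrt_nonneg c),
    integral_id, sq_sqrt hc]
  · simp
  · exact (continuous_id.integrableOn_Icc).mono_set Set.Ioc_subset_Icc_self
  · exact (ae_restrict_iff' measurableSet_Ioc).2 (.of_forall fun r hr => hr.1.le)

/-- Area of a polar region `r² ≤ ρ(θ)`. -/
lemma volume_of_polar_sq_le {s : Set (ℝ × ℝ)} (hs : MeasurableSet s) {ρ : ℝ → ℝ}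
    (hρ : Continuous ρ) (hρ0 : ∀ θ, 0 ≤ ρ θ)
    (h : ∀ r θ, (r * cos θ, r * sin θ) ∈ s ↔ r ^ 2 ≤ ρ θ) :
    (volume s).toReal = ∫ θ in (-π)..π, ρ θ / 2 := by
  have hmeas : Measurable fun p : ℝ × ℝ =>
      ENNReal.ofReal p.1 • s.indicator (1 : ℝ × ℝ → ENNReal) (polarCoord.symm p) :=
    (ENNReal.measurable_ofReal.comp measurable_fst).smul
      ((measurable_one.indicator hs).comp continuous_polarCoord_symm.measurable)
  have hinner (θ : ℝ) : ∫⁻ r in Set.Ioi (0 : ℝ),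
      ENNReal.ofReal r • s.indicator (1 : ℝ × ℝ → ENNReal) (polarCoord.symm (r, θ))
      = ENNReal.ofReal (ρ θ / 2) := by
    rw [← lintegral_Ioi_indicator_sq_le (hρ0 θ)]
    refine lintegral_congr fun r => ?_
    have hr := h r θ
    by_cases hle : r ^ 2 ≤ ρ θ <;> simp [Set.indicator, hr, hle]
  have hint : IntegrableOn (fun θ => ρ θ / 2) (Set.Ioo (-π) π) :=
    (hρ.div_const 2).integrableOn_Icc.mono_set Set.Ioo_subset_Icc_self
  rw [← lintegral_indicator_one hs, ← lintegral_comp_polarCoord_symm, polarCoord_target,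
    Measure.volume_eq_prod, ← Measure.prod_restrict, lintegral_prod_symm _ hmeas.aemeasurable]
  simp_rw [hinner]
  rw [← ofReal_integral_eq_lintegral_ofReal hint
      (.of_forall fun θ => div_nonneg (hρ0 θ) two_pos.le),
    ENNReal.toReal_ofReal (integral_nonneg fun θ => div_nonneg (hρ0 θ) two_pos.le),
    intervalIntegral.integral_of_le (by linarith [pi_pos]), integral_Ioc_eq_integral_Ioo]

lemma integral_comp_sin_two_mul_sq {g : ℝ → ℝ} (hg : Continuous g) :
    ∫ θ in (-π)..π, g (sin (2 * θ) ^ 2) = 4 * ∫ t in (0 : ℝ)..(π / 2), g (sin t ^ 2) := by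
  have hper : Function.Periodic (fun t => g (sin t ^ 2)) π := fun t => by simp
  have hi (u v : ℝ) : IntervalIntegrable (fun t => g (sin t ^ 2)) volume u v :=
    Continuous.intervalIntegrable (by fun_prop) _ _
  have h4 := hper.intervalIntegral_add_zsmul_eq 4 (-(2 * π)) hi
  have hshift := hper.intervalIntegral_add_eq (-(2 * π)) 0
  have hrefl : ∫ t in (π / 2)..π, g (sin t ^ 2) = ∫ t in (0 : ℝ)..(π / 2), g (sin t ^ 2) := by
    have := intervalIntegral.integral_comp_sub_left (a := 0) (b := π / 2)
      (fun t => g (sin t ^ 2)) π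
    simp only [sin_pi_sub, sub_zero] at this
    rw [this]
    congr 1
    ring
  have hsplit := intervalIntegral.integral_add_adjacent_intervals (hi 0 (π / 2)) (hi (π / 2) π)
  rw [intervalIntegral.integral_comp_mul_left (fun t => g (sin t ^ 2)) two_ne_zero]
  rw [show -(2 * π) + (4 : ℤ) • π = 2 * π by simp; ring, hshift] at h4
  rw [mul_neg, h4, zero_add, ← hsplit, hrefl]
  simp
  ring

/-- The area enclosed by the Cassini oval `(x² + y²)² − 2b²(x² − y²) = a⁴ − b⁴`
(for `0 < b < a`) equals `2a² E(b²/a²)`, where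
`E(k) = ∫₀^{π/2} √(1 − k² sin²t) dt` is the complete elliptic integral
of the second kind. -/
theorem stmt_8 (a b : ℝ) (hb : 0 < b) (hba : b < a) :
    (volume {p : ℝ × ℝ |
        (p.1 ^ 2 + p.2 ^ 2) ^ 2 - 2 * b ^ 2 * (p.1 ^ 2 - p.2 ^ 2) ≤ a ^ 4 - b ^ 4}).toReal
      = 2 * a ^ 2 *
        ∫ t in (0 : ℝ)..(Real.pi / 2),
          Real.sqrt (1 - (b ^ 2 / a ^ 2) ^ 2 * Real.sin t ^ 2) := by
  have ha : 0 < a := hb.trans hba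
  have hmeas : MeasurableSet {p : ℝ × ℝ |
      (p.1 ^ 2 + p.2 ^ 2) ^ 2 - 2 * b ^ 2 * (p.1 ^ 2 - p.2 ^ 2) ≤ a ^ 4 - b ^ 4} :=
    measurableSet_le (by fun_prop) (by fun_prop)
  rw [volume_of_polar_sq_le hmeas
    (ρ := fun θ => b ^ 2 * cos (2 * θ) + √(a ^ 4 - b ^ 4 * sin (2 * θ) ^ 2))
    (by fun_prop) (cassini_radius_sq_nonneg hb hba) (cassini_polar_iff hb hba)]
  have hsqrt (θ : ℝ) : √(a ^ 4 - b ^ 4 * sin (2 * θ) ^ 2)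
      = a ^ 2 * √(1 - (b ^ 2 / a ^ 2) ^ 2 * sin (2 * θ) ^ 2) := by
    rw [← sqrt_sq (sq_nonneg a), ← sqrt_mul (by positivity), sqrt_sq (sq_nonneg a)]
    congr 1
    field_simp
  have hcos : ∫ θ in (-π)..π, cos (2 * θ) = 0 := by
    rw [intervalIntegral.integral_comp_mul_left cos two_ne_zero, integral_cos]
    simp
  simp_rw [hsqrt]
  rw [intervalIntegral.integral_div, intervalIntegral.integral_add
      (Continuous.intervalIntegrable (by fun_prop) _ _)
      (Continuous.intervalIntegrable (by fun_prop) _ _),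
    intervalIntegral.integral_const_mul, intervalIntegral.integral_const_mul, hcos,
    integral_comp_sin_two_mul_sq (g := fun x => √(1 - (b ^ 2 / a ^ 2) ^ 2 * x)) (by fun_prop)]
  ring
end

section
/- Fix b > 0. The function f(a) = 2a²·E(b²/a²), defined for a > b, is differentiable and f'(a) = 4a·K(b²/a²), where K(k) = ∫₀^{π/2} dt/√(1 − k²·sin²t) and E(k) = ∫₀^{π/2} √(1 − k²·sin²t) dt. Consequently, along the Cassini-oval evolution with b constant, the enclosed area A(t) = 2a(t)²·E(b²/a(t)²) satisfies Ȧ/A = 2·(ȧ/a)·K(b²/a²)/E(b²/a²), which determines the gap width via ḣ/h = −Ȧ/A. -/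
/-- The radicand of the complete elliptic integrals is bounded below by `1 - r ^ 2`. -/
theorem one_sub_sq_le_one_sub_sq_mul_sin_sq {k r : ℝ} (hk : |k| ≤ r) (t : ℝ) :
    1 - r ^ 2 ≤ 1 - k ^ 2 * Real.sin t ^ 2 := by
  have h1 : k ^ 2 ≤ r ^ 2 := sq_le_sq' (abs_le.mp hk).1 (abs_le.mp hk).2
  nlinarith [Real.sin_sq_le_one t, sq_nonneg k]

theorem one_sub_sq_mul_sin_sq_pos {k : ℝ} (hk : |k| < 1) (t : ℝ) :
    0 < 1 - k ^ 2 * Real.sin t ^ 2 := by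
  have h1 : |k| ^ 2 < 1 := by nlinarith [abs_nonneg k]
  exact (sub_pos.mpr h1).trans_le (one_sub_sq_le_one_sub_sq_mul_sin_sq le_rfl t)

theorem continuous_div_sqrt_one_sub_sq_mul_sin_sq {k : ℝ} (hk : |k| < 1) {g : ℝ → ℝ}
    (hg : Continuous g) :
    Continuous fun t => g t / Real.sqrt (1 - k ^ 2 * Real.sin t ^ 2) :=
  hg.div (by fun_prop) fun t => (Real.sqrt_pos.mpr (one_sub_sq_mul_sin_sq_pos hk t)).ne'

/-- Differentiation of the complete elliptic integral of the second kind under the integral. -/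
theorem hasDerivAt_ellipticE {k : ℝ} (hk : |k| < 1) :
    HasDerivAt
      (fun x : ℝ => ∫ t in (0 : ℝ)..(Real.pi / 2), Real.sqrt (1 - x ^ 2 * Real.sin t ^ 2))
      (∫ t in (0 : ℝ)..(Real.pi / 2),
        -(k * Real.sin t ^ 2) / Real.sqrt (1 - k ^ 2 * Real.sin t ^ 2)) k := by
  obtain ⟨r, hkr, hr⟩ := exists_between hk
  have hr0 : 0 ≤ r := (abs_nonneg k).trans hkr.le
  have hr2 : 0 < 1 - r ^ 2 := by nlinarith
  have hmem : Set.Ioo (-r) r ∈ nhds k := Ioo_mem_nhds (abs_lt.mp hkr).1 (abs_lt.mp hkr).2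
  refine (intervalIntegral.hasDerivAt_integral_of_dominated_loc_of_deriv_le
    (F := fun x t => Real.sqrt (1 - x ^ 2 * Real.sin t ^ 2))
    (F' := fun x t => -(x * Real.sin t ^ 2) / Real.sqrt (1 - x ^ 2 * Real.sin t ^ 2))
    (bound := fun _ => 1 / Real.sqrt (1 - r ^ 2)) hmem ?_ ?_ ?_ ?_ ?_ ?_).2
  · exact .of_forall fun x => Continuous.aestronglyMeasurable (by fun_prop)
  · exact Continuous.intervalIntegrable (by fun_prop) _ _
  · exact (continuous_div_sqrt_one_sub_sq_mul_sin_sq hk (by fun_prop)).aestronglyMeasurable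
  · refine .of_forall fun t _ x hx => ?_
    have hxr : |x| ≤ r := (abs_lt.mpr hx).le
    rw [norm_div, norm_neg, norm_mul, Real.norm_eq_abs, Real.norm_eq_abs, Real.norm_eq_abs,
      abs_of_nonneg (Real.sqrt_nonneg _), abs_of_nonneg (sq_nonneg (Real.sin t))]
    have hs : Real.sqrt (1 - r ^ 2) ≤ Real.sqrt (1 - x ^ 2 * Real.sin t ^ 2) :=
      Real.sqrt_le_sqrt (one_sub_sq_le_one_sub_sq_mul_sin_sq hxr t)
    have hn : |x| * Real.sin t ^ 2 ≤ 1 :=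
      mul_le_one₀ (hxr.trans hr.le) (sq_nonneg _) (Real.sin_sq_le_one t)
    exact div_le_div₀ zero_le_one hn (Real.sqrt_pos.mpr hr2) hs
  · exact intervalIntegrable_const
  · refine .of_forall fun t _ x hx => ?_
    have hpos := one_sub_sq_mul_sin_sq_pos ((abs_lt.mpr hx).trans hr) t
    have h := (((hasDerivAt_pow 2 x).mul_const (Real.sin t ^ 2)).const_sub 1).sqrt hpos.ne'
    refine h.congr_deriv ?_
    rw [← mul_div_mul_left _ (Real.sqrt _) (two_ne_zero (α := ℝ))]
    congr 1
    push_cast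
    ring

/-- The relation `k E'(k) = E(k) - K(k)` between the complete elliptic integrals. -/
theorem mul_integral_deriv_ellipticE {k : ℝ} (hk : |k| < 1) :
    k * (∫ t in (0 : ℝ)..(Real.pi / 2),
        -(k * Real.sin t ^ 2) / Real.sqrt (1 - k ^ 2 * Real.sin t ^ 2)) =
      (∫ t in (0 : ℝ)..(Real.pi / 2), Real.sqrt (1 - k ^ 2 * Real.sin t ^ 2)) -
        ∫ t in (0 : ℝ)..(Real.pi / 2), 1 / Real.sqrt (1 - k ^ 2 * Real.sin t ^ 2) := by
  rw [← intervalIntegral.integral_const_mul, ← intervalIntegral.integral_sub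
    (Continuous.intervalIntegrable (by fun_prop) _ _)
    ((continuous_div_sqrt_one_sub_sq_mul_sin_sq hk continuous_const).intervalIntegrable _ _)]
  refine intervalIntegral.integral_congr fun t _ => ?_
  have hpos := one_sub_sq_mul_sin_sq_pos hk t
  have hne := (Real.sqrt_pos.mpr hpos).ne'
  have hsq := Real.sq_sqrt hpos.le
  generalize Real.sqrt (1 - k ^ 2 * Real.sin t ^ 2) = s at hne hsq ⊢
  field_simp
  linarith

theorem ellipticE_pos {k : ℝ} (hk : |k| < 1) :
    0 < ∫ t in (0 : ℝ)..(Real.pi / 2), Real.sqrt (1 - k ^ 2 * Real.sin t ^ 2) :=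
  intervalIntegral.intervalIntegral_pos_of_pos
    (Continuous.intervalIntegrable (by fun_prop) _ _)
    (fun t => Real.sqrt_pos.mpr (one_sub_sq_mul_sin_sq_pos hk t)) (by positivity)


/-- With `K(k) = ∫₀^{π/2} dt/√(1 − k² sin²t)` and `E(k) = ∫₀^{π/2} √(1 − k² sin²t) dt`,
the Cassini-oval area function `f(a) = 2a² E(b²/a²)` (for `a > b > 0`) satisfies
`f'(a) = 4a K(b²/a²)`; consequently along an evolution `a(t)` with `ȧ = a'(t)`,
`Ȧ/A = 2(ȧ/a) K(b²/a²)/E(b²/a²)` (which determines the gap via `ḣ/h = −Ȧ/A`). -/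
theorem stmt_9 (b : ℝ) (hb : 0 < b) :
    let K : ℝ → ℝ := fun k =>
      ∫ t in (0 : ℝ)..(Real.pi / 2), 1 / Real.sqrt (1 - k ^ 2 * Real.sin t ^ 2)
    let E : ℝ → ℝ := fun k =>
      ∫ t in (0 : ℝ)..(Real.pi / 2), Real.sqrt (1 - k ^ 2 * Real.sin t ^ 2)
    let f : ℝ → ℝ := fun a => 2 * a ^ 2 * E (b ^ 2 / a ^ 2)
    (∀ a : ℝ, b < a → HasDerivAt f (4 * a * K (b ^ 2 / a ^ 2)) a) ∧
    (∀ (α : ℝ → ℝ) (t adot : ℝ), HasDerivAt α adot t → b < α t →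
      deriv (fun s => f (α s)) t / f (α t)
        = 2 * (adot / α t) * (K (b ^ 2 / (α t) ^ 2) / E (b ^ 2 / (α t) ^ 2))) := by
  intro K E f
  have hmod : ∀ a : ℝ, b < a → |b ^ 2 / a ^ 2| < 1 := fun a ha => by
    have ha0 := hb.trans ha
    rw [abs_of_nonneg (by positivity), div_lt_one (by positivity)]
    exact pow_lt_pow_left₀ ha hb.le two_ne_zero
  have hf : ∀ a : ℝ, b < a → HasDerivAt f (4 * a * K (b ^ 2 / a ^ 2)) a := fun a ha => by
    have ha0 : a ≠ 0 := (hb.trans ha).ne'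
    have hrel := mul_integral_deriv_ellipticE (hmod a ha)
    have hE := hasDerivAt_ellipticE (hmod a ha)
    have hk : HasDerivAt (fun x : ℝ => b ^ 2 / x ^ 2) (-2 * b ^ 2 / a ^ 3) a := by
      refine ((hasDerivAt_const a (b ^ 2)).div (hasDerivAt_pow 2 a)
        (pow_ne_zero 2 ha0)).congr_deriv ?_
      push_cast
      field_simp
      ring
    refine (((hasDerivAt_pow 2 a).const_mul 2).mul (hE.comp a hk)).congr_deriv ?_
    change _ * E (b ^ 2 / a ^ 2) + _ = _
    change _ = E (b ^ 2 / a ^ 2) - K (b ^ 2 / a ^ 2) at hrel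
    rw [eq_sub_iff_add_eq, ← eq_sub_iff_add_eq'] at hrel
    rw [hrel]
    push_cast
    field_simp
    ring
  refine ⟨hf, fun α t adot hα ht => ?_⟩
  have hα0 : α t ≠ 0 := (hb.trans ht).ne'
  have hE : E (b ^ 2 / α t ^ 2) ≠ 0 := (ellipticE_pos (hmod _ ht)).ne'
  have hd : deriv (fun s => f (α s)) t = 4 * α t * K (b ^ 2 / α t ^ 2) * adot :=
    ((hf (α t) ht).comp t hα).deriv
  rw [hd]
  change _ / (2 * α t ^ 2 * E (b ^ 2 / α t ^ 2)) = _
  field_simp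
  ring
end

section
/- Let 0 < b < a. Then ∫₀^b x² dx/√((b²x² + a⁴ − b⁴)(b² − x²)) = (a²/b²)·(E(b²/a²) − (1 − b⁴/a⁴)·K(b²/a²)), where K(k) = ∫₀^{π/2} dt/√(1 − k²·sin²t) and E(k) = ∫₀^{π/2} √(1 − k²·sin²t) dt. -/
open MeasureTheory Set in
/-- The change of variables `x = b cos t` on `(0, b)`. No integrability is required. -/
theorem integral_eq_integral_comp_mul_cos {b : ℝ} (hb : 0 < b) (g : ℝ → ℝ) :
    (∫ x in (0 : ℝ)..b, g x)
      = ∫ t in Ioo (0 : ℝ) (Real.pi / 2), b * Real.sin t * g (b * Real.cos t) := by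
  have himage : (fun t => b * Real.cos t) '' Ioo (0 : ℝ) (Real.pi / 2) = Ioo 0 b := by
    ext x
    constructor
    · rintro ⟨t, ⟨ht0, ht1⟩, rfl⟩
      have hcos : 0 < Real.cos t := Real.cos_pos_of_mem_Ioo ⟨by linarith, ht1⟩
      have hlt : Real.cos t < 1 := by
        simpa using Real.cos_lt_cos_of_nonneg_of_le_pi_div_two le_rfl ht1.le ht0
      exact ⟨mul_pos hb hcos, by nlinarith⟩
    · rintro ⟨hx0, hxb⟩
      have h0 : 0 < x / b := div_pos hx0 hb
      have h1 : x / b < 1 := (div_lt_one hb).2 hxb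
      refine ⟨Real.arccos (x / b),
        ⟨Real.arccos_pos.2 h1, Real.arccos_lt_pi_div_two.2 h0⟩, ?_⟩
      simp only [Real.cos_arccos (by linarith) h1.le]
      field_simp
  have hinj : InjOn (fun t => b * Real.cos t) (Ioo (0 : ℝ) (Real.pi / 2)) := by
    intro s hs t ht hst
    have hpi := Real.pi_pos
    exact Real.injOn_cos ⟨hs.1.le, by linarith [hs.2]⟩ ⟨ht.1.le, by linarith [ht.2]⟩
      (mul_left_cancel₀ hb.ne' hst)
  have hderiv : ∀ t ∈ Ioo (0 : ℝ) (Real.pi / 2), HasDerivWithinAt (fun t => b * Real.cos t)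
      (b * -Real.sin t) (Ioo (0 : ℝ) (Real.pi / 2)) t :=
    fun t _ => ((Real.hasDerivAt_cos t).const_mul b).hasDerivWithinAt
  rw [intervalIntegral.integral_of_le hb.le, integral_Ioc_eq_integral_Ioo, ← himage,
    integral_image_eq_integral_abs_deriv_smul measurableSet_Ioo hderiv hinj]
  refine setIntegral_congr_fun measurableSet_Ioo fun t ht => ?_
  have hsin : 0 < Real.sin t := Real.sin_pos_of_mem_Ioo ⟨ht.1, by linarith [ht.2, Real.pi_pos]⟩
  simp only [smul_eq_mul, mul_neg, abs_neg, abs_of_pos (mul_pos hb hsin)]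


/-- For `0 < b < a`,
`∫₀^b x² dx/√((b²x² + a⁴ − b⁴)(b² − x²)) = (a²/b²)(E(b²/a²) − (1 − b⁴/a⁴) K(b²/a²))`,
with `K(k) = ∫₀^{π/2} dt/√(1 − k² sin²t)` and `E(k) = ∫₀^{π/2} √(1 − k² sin²t) dt`. -/
theorem stmt_12 (a b : ℝ) (hb : 0 < b) (hba : b < a) :
    (∫ x in (0 : ℝ)..b,
        x ^ 2 / Real.sqrt ((b ^ 2 * x ^ 2 + a ^ 4 - b ^ 4) * (b ^ 2 - x ^ 2)))
      = (a ^ 2 / b ^ 2) *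
        ((∫ t in (0 : ℝ)..(Real.pi / 2),
            Real.sqrt (1 - (b ^ 2 / a ^ 2) ^ 2 * Real.sin t ^ 2))
          - (1 - b ^ 4 / a ^ 4) *
            ∫ t in (0 : ℝ)..(Real.pi / 2),
              1 / Real.sqrt (1 - (b ^ 2 / a ^ 2) ^ 2 * Real.sin t ^ 2)) := by
  have ha : 0 < a := hb.trans hba
  have hk : b ^ 2 / a ^ 2 < 1 := (div_lt_one (by positivity)).2 (by nlinarith)
  have hk0 : 0 < b ^ 2 / a ^ 2 := by positivity
  have hpos : ∀ t : ℝ, 0 < 1 - (b ^ 2 / a ^ 2) ^ 2 * Real.sin t ^ 2 := fun t => by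
    have h1 := Real.sin_sq_le_one t
    have h2 : (b ^ 2 / a ^ 2) ^ 2 < 1 := by nlinarith
    nlinarith [sq_nonneg (b ^ 2 / a ^ 2), sq_nonneg (Real.sin t)]
  have hE : Continuous fun t : ℝ => Real.sqrt (1 - (b ^ 2 / a ^ 2) ^ 2 * Real.sin t ^ 2) := by
    fun_prop
  have hK : Continuous fun t : ℝ =>
      1 / Real.sqrt (1 - (b ^ 2 / a ^ 2) ^ 2 * Real.sin t ^ 2) :=
    continuous_const.div hE fun t => (Real.sqrt_pos.2 (hpos t)).ne'
  rw [← intervalIntegral.integral_const_mul, ← intervalIntegral.integral_sub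
    (hE.intervalIntegrable _ _) ((hK.const_mul _).intervalIntegrable _ _),
    ← intervalIntegral.integral_const_mul, integral_eq_integral_comp_mul_cos hb,
    intervalIntegral.integral_of_le (by positivity),
    MeasureTheory.integral_Ioc_eq_integral_Ioo]
  refine MeasureTheory.setIntegral_congr_fun measurableSet_Ioo fun t ht => ?_
  have hsin : 0 < Real.sin t := Real.sin_pos_of_mem_Ioo ⟨ht.1, by linarith [ht.2, Real.pi_pos]⟩
  have hcos : Real.cos t ^ 2 = 1 - Real.sin t ^ 2 := Real.cos_sq' t
  have hprod : (b ^ 2 * (b * Real.cos t) ^ 2 + a ^ 4 - b ^ 4) * (b ^ 2 - (b * Real.cos t) ^ 2)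
      = (a ^ 2 * b * Real.sin t) ^ 2 * (1 - (b ^ 2 / a ^ 2) ^ 2 * Real.sin t ^ 2) := by
    rw [mul_pow b, hcos]
    field_simp
    ring
  rw [hprod, Real.sqrt_mul (sq_nonneg _), Real.sqrt_sq (by positivity), mul_pow b, hcos]
  have hS := Real.sqrt_pos.2 (hpos t)
  have hS2 := Real.sq_sqrt (hpos t).le
  set S := Real.sqrt (1 - (b ^ 2 / a ^ 2) ^ 2 * Real.sin t ^ 2)
  field_simp
  rw [hS2]
  field_simp
  ring
end

section
/- Let 0 < b < a and set K = K(b²/a²), E = E(b²/a²). Then ∫_{−b}^{b} (a⁴·E − (a⁴ − b⁴)·K − b²·K·x²)/√((b²x² + a⁴ − b⁴)(b² − x²)) dx = 0. In other words, the sink/source density μ₂ supported on the segment [−b, b] in the Cassini-oval solution, whose numerator B₁x² + B₂ is proportional to −b²·K·x² + a⁴·E − (a⁴ − b⁴)·K, has zero total flux, consistent with volume conservation. -/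
open MeasureTheory Set in
/-- The substitution `x = b cos t`; no integrability is required. -/
theorem integral_neg_self_eq_integral_comp_mul_cos {b : ℝ} (hb : 0 < b) (f : ℝ → ℝ) :
    ∫ x in (-b)..b, f x = ∫ t in (0 : ℝ)..Real.pi, b * Real.sin t * f (b * Real.cos t) := by
  have himage : (fun t => b * Real.cos t) '' Ioo 0 Real.pi = Ioo (-b) b := by
    ext x
    constructor
    · rintro ⟨t, ⟨ht0, htpi⟩, rfl⟩
      have h1 : Real.cos t < Real.cos 0 :=
        Real.strictAntiOn_cos ⟨le_rfl, Real.pi_pos.le⟩ ⟨ht0.le, htpi.le⟩ ht0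
      have h2 : Real.cos Real.pi < Real.cos t :=
        Real.strictAntiOn_cos ⟨ht0.le, htpi.le⟩ ⟨Real.pi_pos.le, le_rfl⟩ htpi
      rw [Real.cos_zero] at h1
      rw [Real.cos_pi] at h2
      constructor <;> dsimp only <;> nlinarith
    · rintro ⟨hx1, hx2⟩
      have h1 : -1 < x / b := by rw [lt_div_iff₀ hb]; linarith
      have h2 : x / b < 1 := by rw [div_lt_one hb]; exact hx2
      refine ⟨Real.arccos (x / b), ⟨Real.arccos_pos.2 h2, ?_⟩, ?_⟩
      · exact lt_of_le_of_ne (Real.arccos_le_pi _) fun h => by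
          rw [Real.arccos_eq_pi] at h
          linarith
      · dsimp only
        rw [Real.cos_arccos h1.le h2.le]
        field_simp
  have hinj : InjOn (fun t => b * Real.cos t) (Ioo 0 Real.pi) := fun s hs t ht hst =>
    Real.injOn_cos (Ioo_subset_Icc_self hs) (Ioo_subset_Icc_self ht)
      (mul_left_cancel₀ hb.ne' hst)
  rw [intervalIntegral.integral_of_le (by linarith), intervalIntegral.integral_of_le Real.pi_pos.le,
    integral_Ioc_eq_integral_Ioo, integral_Ioc_eq_integral_Ioo, ← himage,
    integral_image_eq_integral_abs_deriv_smul measurableSet_Ioo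
      (fun t _ => ((Real.hasDerivAt_cos t).const_mul b).hasDerivWithinAt) hinj]
  refine setIntegral_congr_fun measurableSet_Ioo fun t ht => ?_
  have hs := Real.sin_pos_of_mem_Ioo ht
  rw [mul_neg, abs_neg, abs_of_pos (by positivity), smul_eq_mul]

/-- An integrand symmetric about `π / 2` integrates over `[0, π]` to twice its integral over
`[0, π / 2]`. -/
theorem integral_comp_sin_zero_pi {g : ℝ → ℝ} (hg : Continuous fun t => g (Real.sin t)) :
    ∫ t in (0 : ℝ)..Real.pi, g (Real.sin t) =
      2 * ∫ t in (0 : ℝ)..(Real.pi / 2), g (Real.sin t) := by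
  have h := intervalIntegral.integral_comp_sub_left (a := 0) (b := Real.pi / 2)
    (fun t => g (Real.sin t)) Real.pi
  simp only [Real.sin_pi_sub, sub_zero, sub_half] at h
  rw [← intervalIntegral.integral_add_adjacent_intervals (hg.intervalIntegrable 0 (Real.pi / 2))
    (hg.intervalIntegrable _ _), ← h, two_mul]

/-- Zero total flux of the interior sink/source density in the Cassini-oval exact
solution: for `0 < b < a`, with `K = K(b²/a²)` and `E = E(b²/a²)`,
`∫_{−b}^{b} (a⁴E − (a⁴ − b⁴)K − b²K x²)/√((b²x² + a⁴ − b⁴)(b² − x²)) dx = 0`,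
consistent with volume conservation. -/
theorem stmt_13 (a b : ℝ) (hb : 0 < b) (hba : b < a) :
    let K : ℝ := ∫ t in (0 : ℝ)..(Real.pi / 2),
      1 / Real.sqrt (1 - (b ^ 2 / a ^ 2) ^ 2 * Real.sin t ^ 2)
    let E : ℝ := ∫ t in (0 : ℝ)..(Real.pi / 2),
      Real.sqrt (1 - (b ^ 2 / a ^ 2) ^ 2 * Real.sin t ^ 2)
    (∫ x in (-b)..b,
        (a ^ 4 * E - (a ^ 4 - b ^ 4) * K - b ^ 2 * K * x ^ 2)
          / Real.sqrt ((b ^ 2 * x ^ 2 + a ^ 4 - b ^ 4) * (b ^ 2 - x ^ 2))) = 0 := by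
  intro K E
  have ha : 0 < a := hb.trans hba
  have hk : (b ^ 2 / a ^ 2) ^ 2 < 1 := by
    have : b ^ 2 / a ^ 2 < 1 := by
      rw [div_lt_one (by positivity)]
      gcongr
    exact pow_lt_one₀ (by positivity) this two_ne_zero
  have hpos (t : ℝ) : 0 < 1 - (b ^ 2 / a ^ 2) ^ 2 * Real.sin t ^ 2 := by
    nlinarith [Real.sin_sq_le_one t, sq_nonneg (b ^ 2 / a ^ 2)]
  have hE : Continuous fun t => Real.sqrt (1 - (b ^ 2 / a ^ 2) ^ 2 * Real.sin t ^ 2) := by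
    fun_prop
  have hK : Continuous fun t => 1 / Real.sqrt (1 - (b ^ 2 / a ^ 2) ^ 2 * Real.sin t ^ 2) :=
    continuous_const.div hE fun t => (Real.sqrt_pos.2 (hpos t)).ne'
  have hK2 := integral_comp_sin_zero_pi
    (g := fun s => 1 / Real.sqrt (1 - (b ^ 2 / a ^ 2) ^ 2 * s ^ 2)) hK
  have hE2 := integral_comp_sin_zero_pi
    (g := fun s => Real.sqrt (1 - (b ^ 2 / a ^ 2) ^ 2 * s ^ 2)) hE
  rw [integral_neg_self_eq_integral_comp_mul_cos hb]
  have hcongr : ∫ t in (0 : ℝ)..Real.pi, b * Real.sin t *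
        ((a ^ 4 * E - (a ^ 4 - b ^ 4) * K - b ^ 2 * K * (b * Real.cos t) ^ 2) /
          Real.sqrt ((b ^ 2 * (b * Real.cos t) ^ 2 + a ^ 4 - b ^ 4) *
            (b ^ 2 - (b * Real.cos t) ^ 2))) =
      ∫ t in (0 : ℝ)..Real.pi,
        (a ^ 2 * E * (1 / Real.sqrt (1 - (b ^ 2 / a ^ 2) ^ 2 * Real.sin t ^ 2)) -
          a ^ 2 * K * Real.sqrt (1 - (b ^ 2 / a ^ 2) ^ 2 * Real.sin t ^ 2)) := by
    rw [intervalIntegral.integral_of_le Real.pi_pos.le,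
      intervalIntegral.integral_of_le Real.pi_pos.le,
      MeasureTheory.integral_Ioc_eq_integral_Ioo, MeasureTheory.integral_Ioc_eq_integral_Ioo]
    refine MeasureTheory.setIntegral_congr_fun measurableSet_Ioo fun t ht => ?_
    have hs := Real.sin_pos_of_mem_Ioo ht
    have hΔ := Real.sqrt_pos.2 (hpos t)
    have hΔsq := Real.sq_sqrt (hpos t).le
    set Δ := Real.sqrt (1 - (b ^ 2 / a ^ 2) ^ 2 * Real.sin t ^ 2)
    have hΔa : a ^ 4 * Δ ^ 2 = a ^ 4 - b ^ 4 * Real.sin t ^ 2 := by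
      rw [hΔsq]
      field_simp
    have hsqrt : Real.sqrt ((b ^ 2 * (b * Real.cos t) ^ 2 + a ^ 4 - b ^ 4) *
        (b ^ 2 - (b * Real.cos t) ^ 2)) = a ^ 2 * Δ * (b * Real.sin t) := by
      rw [Real.sqrt_eq_iff_mul_self_eq_of_pos (by positivity)]
      have : (a ^ 2 * Δ * (b * Real.sin t)) * (a ^ 2 * Δ * (b * Real.sin t)) =
        (a ^ 4 * Δ ^ 2) * (b ^ 2 * Real.sin t ^ 2) := by ring
      rw [this, hΔa, Real.sin_sq]
      ring
    have hnum : a ^ 4 * E - (a ^ 4 - b ^ 4) * K - b ^ 2 * K * (b * Real.cos t) ^ 2 =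
        a ^ 4 * E - K * (a ^ 4 * Δ ^ 2) := by
      rw [hΔa, Real.sin_sq]
      ring
    rw [hsqrt, hnum]
    field_simp
  rw [hcongr, intervalIntegral.integral_sub ((hK.const_mul _).intervalIntegrable _ _)
    ((hE.const_mul _).intervalIntegrable _ _), intervalIntegral.integral_const_mul,
    intervalIntegral.integral_const_mul, hK2, hE2]
  change a ^ 2 * E * (2 * K) - a ^ 2 * K * (2 * E) = 0
  ring
end

section
/- Let 0 < b < a. Then the Cassini oval {(x,y) ∈ ℝ² : (x² + y²)² − 2b²(x² − y²) = a⁴ − b⁴} is a connected subset of ℝ² (a single closed curve). -/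
/-- The squared polar radius of the Cassini oval as a function of the polar angle. -/
noncomputable def cassiniRadiusSq (a b t : ℝ) : ℝ :=
  b ^ 2 * (Real.cos t ^ 2 - Real.sin t ^ 2) +
    √((b ^ 2 * (Real.cos t ^ 2 - Real.sin t ^ 2)) ^ 2 + (a ^ 4 - b ^ 4))

/-- The polar parametrization of the Cassini oval. -/
noncomputable def cassiniParam (a b t : ℝ) : ℝ × ℝ :=
  (√(cassiniRadiusSq a b t) * Real.cos t, √(cassiniRadiusSq a b t) * Real.sin t)

theorem continuous_cassiniParam (a b : ℝ) : Continuous (cassiniParam a b) := by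
  unfold cassiniParam cassiniRadiusSq
  fun_prop

/-- For `0 < k`, the number `m + √(m² + k)` is the only nonnegative root of `s² - 2 m s = k`. -/
theorem nonneg_and_sq_sub_eq_iff {k : ℝ} (hk : 0 < k) (m s : ℝ) :
    0 ≤ s ∧ s ^ 2 - 2 * m * s = k ↔ s = m + √(m ^ 2 + k) := by
  constructor
  · rintro ⟨hs, h⟩
    have hsm : 0 ≤ s - m := by nlinarith [sq_nonneg s]
    rw [show m ^ 2 + k = (s - m) ^ 2 by linarith, Real.sqrt_sq hsm]
    ring
  · rintro rfl
    have hlt : |m| < √(m ^ 2 + k) := Real.lt_sqrt_of_sq_lt (by rw [sq_abs]; linarith)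
    refine ⟨by linarith [neg_abs_le m], ?_⟩
    linear_combination Real.sq_sqrt (show 0 ≤ m ^ 2 + k by positivity)

/-- For `0 < b < a`, the Cassini oval is the range of its polar parametrization. -/
theorem range_cassiniParam {a b : ℝ} (hb : 0 < b) (hba : b < a) :
    Set.range (cassiniParam a b) = {p : ℝ × ℝ |
      (p.1 ^ 2 + p.2 ^ 2) ^ 2 - 2 * b ^ 2 * (p.1 ^ 2 - p.2 ^ 2) = a ^ 4 - b ^ 4} := by
  have hk : 0 < a ^ 4 - b ^ 4 := sub_pos.2 (pow_lt_pow_left₀ hba hb.le (by norm_num))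
  ext ⟨x, y⟩
  simp only [Set.mem_range, Set.mem_ofPred_eq, cassiniParam, Prod.mk.injEq]
  constructor
  · rintro ⟨t, rfl, rfl⟩
    obtain ⟨h0, h⟩ := (nonneg_and_sq_sub_eq_iff hk _ (cassiniRadiusSq a b t)).2 rfl
    rw [mul_pow, mul_pow, Real.sq_sqrt h0, ← mul_add, Real.cos_sq_add_sin_sq]
    linear_combination h
  · intro h
    let z : ℂ := ⟨x, y⟩
    have hx : ‖z‖ * Real.cos z.arg = x := Complex.norm_mul_cos_arg z
    have hy : ‖z‖ * Real.sin z.arg = y := Complex.norm_mul_sin_arg z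
    have hr : ‖z‖ ^ 2 = cassiniRadiusSq a b z.arg := by
      refine (nonneg_and_sq_sub_eq_iff hk _ _).1 ⟨by positivity, ?_⟩
      rw [← hx, ← hy, mul_pow, mul_pow, ← mul_add, Real.cos_sq_add_sin_sq] at h
      linear_combination h
    refine ⟨z.arg, ?_⟩
    rw [← hr, Real.sqrt_sq (norm_nonneg z)]
    exact ⟨hx, hy⟩

/-- For `0 < b < a`, the Cassini oval
`{(x,y) : (x² + y²)² − 2b²(x² − y²) = a⁴ − b⁴}` is a connected subset of `ℝ²`
(a single closed curve). -/
theorem stmt_14 (a b : ℝ) (hb : 0 < b) (hba : b < a) :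
    IsConnected {p : ℝ × ℝ |
      (p.1 ^ 2 + p.2 ^ 2) ^ 2 - 2 * b ^ 2 * (p.1 ^ 2 - p.2 ^ 2) = a ^ 4 - b ^ 4} := by
  rw [← range_cassiniParam hb hba]
  exact isConnected_range (continuous_cassiniParam a b)
end
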